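/- Let 0 < ε < √2 and define p̄ : (−1,∞) → ℝ by p̄(R) = (1+R)^{−2} · exp((2/ε²)(ln(1+R) − R)). Then the function R ↦ R²·p̄(R) is Lebesgue integrable on (−1,∞) and ∫_{−1}^{∞} R²·p̄(R) dR = (ε²/2) · ∫_{−1}^{∞} p̄(R) dR. Equivalently, the second moment of the normalized stationary amplitude distribution is E[R²] = ε²/2. -/

import Mathlib

open MeasureTheory Set

lemma integrableOn_Ioi_neg_one_comp_one_add_iff (h : ℝ → ℝ) :
    IntegrableOn (fun R => h (1 + R)) (Ioi (-1 : ℝ)) ↔ IntegrableOn h (Ioi 0) := by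
  have key := (measurePreserving_add_left volume (1 : ℝ)).integrableOn_comp_preimage
    (measurableEmbedding_addLeft 1) (f := h) (s := Ioi 0)
  simpa [Function.comp_def] using key

lemma integral_Ioi_neg_one_comp_one_add (h : ℝ → ℝ) :
    ∫ R in Ioi (-1 : ℝ), h (1 + R) = ∫ x in Ioi (0 : ℝ), h x := by
  have key := (measurePreserving_add_left volume (1 : ℝ)).setIntegral_preimage_emb
    (measurableEmbedding_addLeft 1) h (Ioi 0)
  simpa using key

lemma integrableOn_rpow_sub_one_mul_exp_neg_mul {a s : ℝ} (ha : 0 < a) (hs : 0 < s) :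
    IntegrableOn (fun x : ℝ => x ^ (s - 1) * Real.exp (-(a * x))) (Ioi 0) := by
  simpa using integrableOn_rpow_mul_exp_neg_mul_rpow (p := 1) (s := s - 1) (by linarith)
    one_pos ha

lemma integral_rpow_mul_exp_neg_mul_add_one {a s : ℝ} (ha : 0 < a) (hs : 0 < s) :
    ∫ x in Ioi (0 : ℝ), x ^ (s + 1 - 1) * Real.exp (-(a * x)) =
      s / a * ∫ x in Ioi (0 : ℝ), x ^ (s - 1) * Real.exp (-(a * x)) := by
  rw [Real.integral_rpow_mul_exp_neg_mul_Ioi (by positivity) ha,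
    Real.integral_rpow_mul_exp_neg_mul_Ioi hs ha, Real.Gamma_add_one hs.ne',
    Real.rpow_add_one (by positivity)]
  ring

/-- For `0 < ε < √2` and
`p̄(R) = (1+R)⁻² exp((2/ε²)(ln(1+R) − R))` on `(−1,∞)`, the function `R ↦ R²·p̄(R)` is
integrable on `(−1,∞)` and `∫ R² p̄(R) dR = (ε²/2) ∫ p̄(R) dR`; i.e. the second moment of
the normalized stationary amplitude distribution is `E[R²] = ε²/2`. -/
theorem stmt14 (ε : ℝ) (hε : 0 < ε) (hε2 : ε < Real.sqrt 2) (pbar : ℝ → ℝ)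
    (hp : ∀ R : ℝ, pbar R = ((1 + R) ^ 2)⁻¹ * Real.exp ((2 / ε ^ 2) * (Real.log (1 + R) - R))) :
    IntegrableOn (fun R => R ^ 2 * pbar R) (Ioi (-1 : ℝ)) ∧
    ∫ R in Ioi (-1 : ℝ), R ^ 2 * pbar R = (ε ^ 2 / 2) * ∫ R in Ioi (-1 : ℝ), pbar R := by
  set a : ℝ := 2 / ε ^ 2 with ha_def
  have hε_sq : ε ^ 2 < 2 := (Real.lt_sqrt hε.le).1 hε2
  have ha : 1 < a := by rwa [ha_def, lt_div_iff₀ (by positivity), one_mul]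
  have ha0 : 0 < a := by linarith
  have hε_half : ε ^ 2 / 2 = 1 / a := by rw [ha_def]; field_simp
  let m : ℝ → ℝ → ℝ := fun s x => x ^ (s - 1) * Real.exp (-(a * x))
  have pbar_eq : ∀ R ∈ Ioi (-1 : ℝ), pbar R = Real.exp a * m (a - 1) (1 + R) := by
    intro R hR
    have hx : 0 < 1 + R := by linarith [mem_Ioi.1 hR]
    have hpow : (1 + R) ^ (a - 1 - 1) = ((1 + R) ^ 2)⁻¹ * (1 + R) ^ a := by
      rw [show a - 1 - 1 = -2 + a by ring, Real.rpow_add hx, Real.rpow_neg hx.le,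
        Real.rpow_ofNat]
    simp only [m]
    rw [hp, hpow, Real.rpow_def_of_pos hx, mul_assoc, mul_left_comm, ← Real.exp_add,
      ← Real.exp_add]
    ring_nf
  let g : ℝ → ℝ := fun x =>
    Real.exp a * (m (a - 1 + 1 + 1) x - 2 * m (a - 1 + 1) x + m (a - 1) x)
  have sq_mul_pbar_eq : ∀ R ∈ Ioi (-1 : ℝ), R ^ 2 * pbar R = g (1 + R) := by
    intro R hR
    have hx : 0 < 1 + R := by linarith [mem_Ioi.1 hR]
    have hm : ∀ s, m (s + 1) (1 + R) = (1 + R) * m s (1 + R) := fun s => by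
      simp only [m]
      rw [show s + 1 - 1 = s - 1 + 1 by ring, Real.rpow_add_one hx.ne']
      ring
    rw [pbar_eq R hR]
    simp only [g, hm]
    ring
  have hint : ∀ s, 0 < s → IntegrableOn (m s) (Ioi 0) := fun s hs =>
    integrableOn_rpow_sub_one_mul_exp_neg_mul ha0 hs
  have h₀ := hint (a - 1) (by linarith)
  have h₁ := (hint (a - 1 + 1) (by linarith)).const_mul 2
  have h₂ := hint (a - 1 + 1 + 1) (by linarith)
  have h₂₁ : Integrable (fun x => m (a - 1 + 1 + 1) x - 2 * m (a - 1 + 1) x)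
      (volume.restrict (Ioi 0)) := h₂.sub h₁
  have hg : IntegrableOn g (Ioi 0) := (h₂₁.add h₀).const_mul (Real.exp a)
  refine ⟨((integrableOn_Ioi_neg_one_comp_one_add_iff g).2 hg).congr_fun
    (fun R hR => (sq_mul_pbar_eq R hR).symm) measurableSet_Ioi, ?_⟩
  have e₁ : ∫ x in Ioi 0, m (a - 1 + 1) x = (a - 1) / a * ∫ x in Ioi 0, m (a - 1) x :=
    integral_rpow_mul_exp_neg_mul_add_one ha0 (by linarith)
  have e₂ : ∫ x in Ioi 0, m (a - 1 + 1 + 1) x =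
      (a - 1 + 1) / a * ∫ x in Ioi 0, m (a - 1 + 1) x :=
    integral_rpow_mul_exp_neg_mul_add_one ha0 (by linarith)
  rw [setIntegral_congr_fun measurableSet_Ioi sq_mul_pbar_eq,
    setIntegral_congr_fun measurableSet_Ioi pbar_eq,
    integral_Ioi_neg_one_comp_one_add g,
    integral_Ioi_neg_one_comp_one_add (fun x => Real.exp a * m (a - 1) x), hε_half]
  simp only [g]
  rw [integral_const_mul, integral_const_mul, integral_add h₂₁ h₀,
    integral_sub h₂ h₁, integral_const_mul, e₂, e₁]
  field_simp
  ring
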